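/- Let N ≥ 1 and M > 0, and let f : ℝ^N → ℝ be measurable with 0 ≤ f ≤ 1 a.e., ∫_{ℝ^N} f(v) dv = M and ∫_{ℝ^N} |v|² f(v) dv < ∞. Then the Csiszár-Kullback type inequality ‖f − F_M‖_{L¹(ℝ^N)}² ≤ 2M (H(f) − H(F_M)) holds. -/

import Mathlib

open MeasureTheory Real Filter
open scoped ENNReal NNReal Topology

noncomputable section

/-- ℝ^N as a Euclidean space. -/
abbrev Evec (N : ℕ) := EuclideanSpace ℝ (Fin N)


/-- `s(r) = (1-r)log(1-r) + r log r` (with the convention `log 0 = 0`, so `s(0)=s(1)=0`). -/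
noncomputable def entFn (r : ℝ) : ℝ := (1 - r) * Real.log (1 - r) + r * Real.log r

/-- The entropy `S(g) = ∫ s(g(v)) dv`. -/
noncomputable def Sent (N : ℕ) (g : Evec N → ℝ) : ℝ := ∫ v : Evec N, entFn (g v)

/-- The kinetic energy `E(g) = (1/2) ∫ |v|² g(v) dv`. -/
noncomputable def Ekin (N : ℕ) (g : Evec N → ℝ) : ℝ := (1 / 2) * ∫ v : Evec N, ‖v‖ ^ 2 * g v

/-- The free energy `H(g) = S(g) + E(g)`. -/
noncomputable def Hfun (N : ℕ) (g : Evec N → ℝ) : ℝ := Sent N g + Ekin N g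

/-- The Fermi-Dirac distribution `F^β(v) = (1 + β e^{|v|²/2})⁻¹`. -/
noncomputable def FD (N : ℕ) (β : ℝ) (v : Evec N) : ℝ := (1 + β * exp (‖v‖ ^ 2 / 2))⁻¹

/-- `β(M)`: the unique `β > 0` such that `F^β` has mass `M` (chosen via `Classical.epsilon`). -/
noncomputable def betaOf (N : ℕ) (M : ℝ) : ℝ :=
  Classical.epsilon (fun β : ℝ => 0 < β ∧ ∫ v : Evec N, FD N β v = M)

/-- The Fermi-Dirac equilibrium `F_M = F^{β(M)}` of mass `M`. -/
noncomputable def FDM (N : ℕ) (M : ℝ) : Evec N → ℝ := FD N (betaOf N M)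



lemma ck_log_bound {x : ℝ} (hx : 0 < x) :
    0 ≤ x * (Real.log x - (x - 1) * (5 * x + 1) / (2 * x * (x + 2))) := by
  set φ : ℝ → ℝ := fun x => Real.log x - (x - 1) * (5 * x + 1) / (2 * x * (x + 2)) with hφ
  have hd : ∀ y : ℝ, 0 < y → HasDerivAt φ ((y - 1) ^ 3 / (y ^ 2 * (y + 2) ^ 2)) y := by
    intro y hy
    have h1 : HasDerivAt (fun y : ℝ => (y - 1) * (5 * y + 1)) (1 * (5 * y + 1) + (y - 1) * (5 * 1)) y :=
      ((hasDerivAt_id y).sub_const 1).mul (((hasDerivAt_id y).const_mul 5).add_const 1)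
    have h2 : HasDerivAt (fun y : ℝ => 2 * y * (y + 2)) (2 * 1 * (y + 2) + 2 * y * 1) y :=
      ((hasDerivAt_id y).const_mul 2).mul ((hasDerivAt_id y).add_const 2)
    have h3 := (Real.hasDerivAt_log hy.ne').sub (h1.div h2 (by positivity))
    refine HasDerivAt.congr_deriv (f := φ) h3 ?_
    have hy2 : y + 2 ≠ 0 := by positivity
    field_simp
    ring
  have h1 : φ 1 = 0 := by simp [hφ]
  have hpos : 0 ≤ φ x := by
    rcases le_total 1 x with h | h
    · have hm : MonotoneOn φ (Set.Ici 1) := by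
        apply monotoneOn_of_hasDerivWithinAt_nonneg (convex_Ici 1)
          (f' := fun y => (y - 1) ^ 3 / (y ^ 2 * (y + 2) ^ 2))
        · intro y hy
          exact (hd y (lt_of_lt_of_le one_pos hy)).continuousAt.continuousWithinAt
        · intro y hy
          rw [interior_Ici] at hy
          exact (hd y (lt_trans one_pos hy)).hasDerivWithinAt
        · intro y hy
          rw [interior_Ici] at hy
          have : 0 ≤ y - 1 := by linarith [Set.mem_Ioi.1 hy]
          positivity
      have := hm (Set.mem_Ici.2 le_rfl) (Set.mem_Ici.2 h) h
      linarith
    · have hm : AntitoneOn φ (Set.Icc x 1) := by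
        apply antitoneOn_of_hasDerivWithinAt_nonpos (convex_Icc x 1)
          (f' := fun y => (y - 1) ^ 3 / (y ^ 2 * (y + 2) ^ 2))
        · intro y hy
          exact (hd y (lt_of_lt_of_le hx hy.1)).continuousAt.continuousWithinAt
        · intro y hy
          rw [interior_Icc] at hy
          exact (hd y (lt_trans hx hy.1)).hasDerivWithinAt
        · intro y hy
          rw [interior_Icc] at hy
          have h0 : 0 ≤ 1 - y := by linarith [hy.2]
          have h3 : 0 ≤ (1 - y) ^ 3 := by positivity
          apply div_nonpos_of_nonpos_of_nonneg
          · nlinarith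
          · positivity
      have := hm (Set.left_mem_Icc.2 h) (Set.right_mem_Icc.2 h) h
      linarith
  exact mul_nonneg hx.le hpos

lemma ck_pt {a b : ℝ} (ha : 0 ≤ a) (hb : 0 < b) :
    (a - b) ^ 2 ≤ (2 / 3) * (a + 2 * b) * (a * Real.log a - a * Real.log b - a + b) := by
  rcases ha.eq_or_lt with rfl | ha
  · simp; nlinarith
  · have hx : 0 < a / b := div_pos ha hb
    have h := ck_log_bound hx
    rw [Real.log_div ha.ne' hb.ne'] at h
    have h2 : 0 ≤ ((2 / 3) * (a + 2 * b) * b) *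
        (a / b * (Real.log a - Real.log b - (a / b - 1) * (5 * (a / b) + 1) / (2 * (a / b) * (a / b + 2)))) :=
      mul_nonneg (by positivity) h
    have e : ((2 / 3) * (a + 2 * b) * b) *
        (a / b * (Real.log a - Real.log b - (a / b - 1) * (5 * (a / b) + 1) / (2 * (a / b) * (a / b + 2))))
        = (2 / 3) * (a + 2 * b) * (a * Real.log a - a * Real.log b - a + b) - (a - b) ^ 2 := by
      field_simp
      ring
    linarith

lemma ck_pt_nonneg {a b : ℝ} (ha : 0 ≤ a) (hb : 0 < b) :
    0 ≤ a * Real.log a - a * Real.log b - a + b := by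
  have h := ck_pt ha hb
  have h2 : 0 < (2 / 3) * (a + 2 * b) := by positivity
  exact nonneg_of_mul_nonneg_right ((sq_nonneg _).trans h) h2

/-- the relative entropy density -/
def ckD (a b : ℝ) : ℝ := entFn a - Real.log (1 - b) - a * (Real.log b - Real.log (1 - b))

lemma ckD_eq (a b : ℝ) : ckD a b = (a * Real.log a - a * Real.log b - a + b) +
    ((1 - a) * Real.log (1 - a) - (1 - a) * Real.log (1 - b) - (1 - a) + (1 - b)) := by
  unfold ckD entFn; ring

lemma ckD_bound {a b : ℝ} (ha : 0 ≤ a) (ha1 : a ≤ 1) (hb : 0 < b) (hb1 : b < 1) :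
    (a - b) ^ 2 ≤ (2 / 3) * (a + 2 * b) * ckD a b := by
  rw [ckD_eq]
  have h1 := ck_pt ha hb
  have h2 := ck_pt_nonneg (sub_nonneg.2 ha1) (sub_pos.2 hb1)
  have h3 : 0 ≤ (2 / 3) * (a + 2 * b) := by positivity
  nlinarith [mul_nonneg h3 h2]

lemma ckD_nonneg {a b : ℝ} (ha : 0 ≤ a) (ha1 : a ≤ 1) (hb : 0 < b) (hb1 : b < 1) :
    0 ≤ ckD a b := by
  rw [ckD_eq]
  exact add_nonneg (ck_pt_nonneg ha hb) (ck_pt_nonneg (sub_nonneg.2 ha1) (sub_pos.2 hb1))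

lemma ckD_self (b : ℝ) : ckD b b = 0 := by
  rw [ckD_eq]; ring

lemma ckD_young {a b t : ℝ} (ha : 0 ≤ a) (ha1 : a ≤ 1) (hb : 0 < b) (hb1 : b < 1) (ht : 0 < t) :
    |a - b| ≤ t * ckD a b + (1 / (6 * t)) * (a + 2 * b) := by
  have h := ckD_bound ha ha1 hb hb1
  have h0 := ckD_nonneg ha ha1 hb hb1
  have hp : 0 ≤ t * ckD a b + (1 / (6 * t)) * (a + 2 * b) := by positivity
  refine abs_le_of_sq_le_sq ?_ hp
  have e : (t * ckD a b + (1 / (6 * t)) * (a + 2 * b)) ^ 2 =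
     (t * ckD a b - (1 / (6 * t)) * (a + 2 * b)) ^ 2 + (2 / 3) * (a + 2 * b) * ckD a b := by
    field_simp
    ring
  rw [e]
  nlinarith [sq_nonneg (t * ckD a b - (1 / (6 * t)) * (a + 2 * b))]

lemma entFn_nonpos {a : ℝ} (ha : 0 ≤ a) (ha1 : a ≤ 1) : entFn a ≤ 0 := by
  unfold entFn
  have h1 := mul_nonpos_of_nonneg_of_nonpos ha (Real.log_nonpos ha ha1)
  have h2 := mul_nonpos_of_nonneg_of_nonpos (sub_nonneg.2 ha1)
    (Real.log_nonpos (sub_nonneg.2 ha1) (by linarith))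
  linarith

lemma gauss_int (N : ℕ) {c : ℝ} (hc : 0 < c) :
    Integrable (fun v : Evec N => Real.exp (-c * ‖v‖ ^ 2)) volume := by
  have h := GaussianFourier.integrable_cexp_neg_mul_sq_norm_add (V := Evec N) (b := (c : ℂ))
    (by simpa using hc) 0 0
  have h2 := h.norm
  refine h2.congr (ae_of_all _ fun v => ?_)
  simp only [Complex.norm_exp]
  congr 1
  simp [← Complex.ofReal_pow]

lemma FD_pos {N : ℕ} {β : ℝ} (hβ : 0 < β) (v : Evec N) : 0 < FD N β v := by
  unfold FD; positivity

lemma FD_lt_one {N : ℕ} {β : ℝ} (hβ : 0 < β) (v : Evec N) : FD N β v < 1 := by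
  unfold FD
  have : 0 < β * exp (‖v‖ ^ 2 / 2) := by positivity
  exact inv_lt_one_of_one_lt₀ (by linarith)

lemma FD_le {N : ℕ} {β : ℝ} (hβ : 0 < β) (v : Evec N) :
    FD N β v ≤ β⁻¹ * Real.exp (-(1 / 2) * ‖v‖ ^ 2) := by
  unfold FD
  have e : -(1 / 2) * ‖v‖ ^ 2 = -(‖v‖ ^ 2 / 2) := by ring
  rw [e, Real.exp_neg, ← mul_inv]
  apply inv_anti₀ (by positivity)
  linarith

lemma FD_cont {N : ℕ} {β : ℝ} (hβ : 0 < β) : Continuous (FD N β) := by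
  unfold FD
  apply Continuous.inv₀ (by fun_prop)
  intro v
  positivity

lemma FD_int {N : ℕ} {β : ℝ} (hβ : 0 < β) : Integrable (FD N β) volume := by
  refine ((gauss_int N (c := 1 / 2) (by norm_num)).const_mul β⁻¹).mono'
    (FD_cont hβ).aestronglyMeasurable (ae_of_all _ fun v => ?_)
  rw [Real.norm_of_nonneg (FD_pos hβ v).le]
  exact FD_le hβ v

lemma FD_energy {N : ℕ} {β : ℝ} (hβ : 0 < β) :
    Integrable (fun v : Evec N => ‖v‖ ^ 2 * FD N β v) volume := by
  refine ((gauss_int N (c := 1 / 4) (by norm_num)).const_mul (4 * β⁻¹)).mono'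
    (((continuous_norm.pow 2).mul (FD_cont hβ)).aestronglyMeasurable) (ae_of_all _ fun v => ?_)
  rw [Real.norm_of_nonneg (mul_nonneg (by positivity) (FD_pos hβ v).le)]
  have h1 : ‖v‖ ^ 2 ≤ 4 * Real.exp ((1 / 4) * ‖v‖ ^ 2) := by
    have := Real.add_one_le_exp ((1 / 4) * ‖v‖ ^ 2)
    linarith
  calc ‖v‖ ^ 2 * FD N β v ≤ (4 * Real.exp ((1 / 4) * ‖v‖ ^ 2)) * (β⁻¹ * Real.exp (-(1 / 2) * ‖v‖ ^ 2)) :=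
        mul_le_mul h1 (FD_le hβ v) (FD_pos hβ v).le (by positivity)
    _ = 4 * β⁻¹ * (Real.exp ((1 / 4) * ‖v‖ ^ 2) * Real.exp (-(1 / 2) * ‖v‖ ^ 2)) := by ring
    _ = 4 * β⁻¹ * Real.exp (-(1 / 4) * ‖v‖ ^ 2) := by
        rw [← Real.exp_add]; congr 2; ring

lemma FD_one_sub {N : ℕ} {β : ℝ} (hβ : 0 < β) (v : Evec N) :
    1 - FD N β v = FD N β v * (β * exp (‖v‖ ^ 2 / 2)) := by
  unfold FD
  have : 0 < 1 + β * exp (‖v‖ ^ 2 / 2) := by positivity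
  field_simp
  ring

lemma FD_log {N : ℕ} {β : ℝ} (hβ : 0 < β) (v : Evec N) :
    Real.log (FD N β v) - Real.log (1 - FD N β v) = - Real.log β - ‖v‖ ^ 2 / 2 := by
  rw [FD_one_sub hβ, Real.log_mul (FD_pos hβ v).ne' (by positivity),
    Real.log_mul hβ.ne' (Real.exp_pos _).ne', Real.log_exp]
  ring

lemma FD_logint {N : ℕ} {β : ℝ} (hβ : 0 < β) :
    Integrable (fun v : Evec N => Real.log (1 - FD N β v)) volume := by
  refine ((gauss_int N (c := 1 / 2) (by norm_num)).const_mul β⁻¹).mono'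
    ((Real.measurable_log.comp ((FD_cont hβ).measurable.const_sub 1)).aestronglyMeasurable)
    (ae_of_all _ fun v => ?_)
  have h1 := FD_pos hβ v
  have h2 := FD_lt_one hβ v
  rw [Real.norm_of_nonpos (Real.log_nonpos (by linarith) (by linarith)), ← Real.log_inv]
  refine (Real.log_le_sub_one_of_pos (inv_pos.2 (by linarith))).trans (le_of_eq ?_)
  have e : -(1 / 2) * ‖v‖ ^ 2 = -(‖v‖ ^ 2 / 2) := by ring
  rw [FD_one_sub hβ, e, Real.exp_neg]
  unfold FD
  have : 0 < 1 + β * exp (‖v‖ ^ 2 / 2) := by positivity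
  field_simp
  ring

lemma beta_exists (N : ℕ) (hN : 1 ≤ N) (M : ℝ) (hM : 0 < M) :
    ∃ β : ℝ, 0 < β ∧ ∫ v : Evec N, FD N β v = M := by
  -- small beta
  obtain ⟨β₁, hβ₁, h₁⟩ : ∃ β : ℝ, 0 < β ∧ M ≤ ∫ v : Evec N, FD N β v := by
    set c := volume.real (Metric.ball (0 : Evec N) 1) with hc
    have hcpos : 0 < c := by
      apply ENNReal.toReal_pos (Metric.measure_ball_pos _ _ one_pos).ne' measure_ball_lt_top.ne
    set R := max 1 (2 * M / c) with hR
    have hR1 : 1 ≤ R := le_max_left _ _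
    have hR2 : 2 * M / c ≤ R := le_max_right _ _
    have hvol : 2 * M ≤ volume.real (Metric.ball (0 : Evec N) R) := by
      rw [measureReal_def, Measure.addHaar_ball_of_pos _ _ (by linarith : 0 < R), ENNReal.toReal_mul,
        ENNReal.toReal_ofReal (by positivity), finrank_euclideanSpace_fin, ← measureReal_def, ← hc]
      have : R ≤ R ^ N := le_self_pow₀ hR1 (by omega)
      rw [div_le_iff₀ hcpos] at hR2
      nlinarith
    refine ⟨Real.exp (-(R ^ 2 / 2)), Real.exp_pos _, ?_⟩
    have hβ := Real.exp_pos (-(R ^ 2 / 2))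
    calc M ≤ ∫ v in Metric.ball (0 : Evec N) R, (1 / 2 : ℝ) := by
          rw [setIntegral_const, smul_eq_mul]; linarith
      _ ≤ ∫ v in Metric.ball (0 : Evec N) R, FD N (Real.exp (-(R ^ 2 / 2))) v := by
          apply setIntegral_mono_on
          · exact integrableOn_const (measure_ball_lt_top.ne)
          · exact (FD_int hβ).integrableOn
          · exact measurableSet_ball
          · intro v hv
            have hv' : ‖v‖ < R := by simpa using hv
            unfold FD
            rw [← Real.exp_add, one_div]
            apply inv_anti₀ (by positivity)
            have : Real.exp (-(R ^ 2 / 2) + ‖v‖ ^ 2 / 2) ≤ 1 := by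
              rw [Real.exp_le_one_iff]
              nlinarith [norm_nonneg v]
            linarith
      _ ≤ ∫ v : Evec N, FD N (Real.exp (-(R ^ 2 / 2))) v :=
          setIntegral_le_integral (FD_int hβ) (ae_of_all _ fun v => (FD_pos hβ v).le)
  obtain ⟨β₂, hβ₂, h₂⟩ : ∃ β : ℝ, β₁ ≤ β ∧ ∫ v : Evec N, FD N β v ≤ M := by
    set G := ∫ v : Evec N, Real.exp (-(1 / 2) * ‖v‖ ^ 2) with hG
    refine ⟨max β₁ (G / M), le_max_left _ _, ?_⟩
    have hβ : 0 < max β₁ (G / M) := lt_of_lt_of_le hβ₁ (le_max_left _ _)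
    have hh : G / M ≤ max β₁ (G / M) := le_max_right _ _
    calc ∫ v : Evec N, FD N (max β₁ (G / M)) v
        ≤ ∫ v : Evec N, (max β₁ (G / M))⁻¹ * Real.exp (-(1 / 2) * ‖v‖ ^ 2) :=
          integral_mono (FD_int hβ) ((gauss_int N (by norm_num)).const_mul _) (FD_le hβ)
      _ = (max β₁ (G / M))⁻¹ * G := integral_const_mul _ _
      _ ≤ M := by
          rw [inv_mul_le_iff₀ hβ]
          rwa [div_le_iff₀ hM] at hh
  have hcont : ContinuousOn (fun β => ∫ v : Evec N, FD N β v) (Set.Icc β₁ β₂) := by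
    apply continuousOn_of_dominated (bound := FD N β₁)
    · intro β hβ
      exact (FD_cont (lt_of_lt_of_le hβ₁ hβ.1)).aestronglyMeasurable
    · intro β hβ
      refine ae_of_all _ fun v => ?_
      rw [Real.norm_of_nonneg (FD_pos (lt_of_lt_of_le hβ₁ hβ.1) v).le]
      unfold FD
      apply inv_anti₀ (by positivity)
      have := mul_le_mul_of_nonneg_right hβ.1 (Real.exp_pos (‖v‖ ^ 2 / 2)).le
      linarith
    · exact FD_int hβ₁
    · refine ae_of_all _ fun v => ?_
      unfold FD
      apply ContinuousOn.inv₀ (by fun_prop)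
      intro β hβ
      have := lt_of_lt_of_le hβ₁ hβ.1
      positivity
  obtain ⟨β, hβ, h⟩ := intermediate_value_Icc' hβ₂ hcont ⟨h₂, h₁⟩
  exact ⟨β, lt_of_lt_of_le hβ₁ hβ.1, h⟩

lemma ckD_FD {N : ℕ} {β : ℝ} (hβ : 0 < β) (v : Evec N) (a : ℝ) :
    ckD a (FD N β v) = entFn a + (1 / 2) * (‖v‖ ^ 2 * a) + Real.log β * a
      - Real.log (1 - FD N β v) := by
  unfold ckD
  rw [FD_log hβ]; ring

lemma ent_int {N : ℕ} {β : ℝ} (hβ : 0 < β) {g : Evec N → ℝ} (hmeas : Measurable g)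
    (hb : ∀ᵐ v : Evec N ∂volume, 0 ≤ g v ∧ g v ≤ 1) (hg : Integrable g volume)
    (hE : Integrable (fun v : Evec N => ‖v‖ ^ 2 * g v) volume) :
    Integrable (fun v => entFn (g v)) volume := by
  have hi : Integrable (fun v : Evec N => (1 / 2) * (‖v‖ ^ 2 * g v) + Real.log β * g v
      - Real.log (1 - FD N β v)) volume :=
    ((hE.const_mul _).add (hg.const_mul _)).sub (FD_logint hβ)
  refine hi.mono' ?_ ?_
  · apply Measurable.aestronglyMeasurable
    unfold entFn
    fun_prop
  · filter_upwards [hb] with v hv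
    rw [Real.norm_of_nonpos (entFn_nonpos hv.1 hv.2)]
    have := ckD_nonneg hv.1 hv.2 (FD_pos hβ v) (FD_lt_one hβ v)
    rw [ckD_FD hβ] at this
    linarith

lemma ckD_integral {N : ℕ} {β : ℝ} (hβ : 0 < β) {g : Evec N → ℝ} (hmeas : Measurable g)
    (hb : ∀ᵐ v : Evec N ∂volume, 0 ≤ g v ∧ g v ≤ 1) (hg : Integrable g volume)
    (hE : Integrable (fun v : Evec N => ‖v‖ ^ 2 * g v) volume) :
    Integrable (fun v => ckD (g v) (FD N β v)) volume ∧
    ∫ v, ckD (g v) (FD N β v) = Hfun N g + Real.log β * (∫ v, g v)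
      - ∫ v : Evec N, Real.log (1 - FD N β v) := by
  have hs := ent_int hβ hmeas hb hg hE
  have i1 : Integrable (fun v : Evec N => (1 / 2) * (‖v‖ ^ 2 * g v)) volume := hE.const_mul _
  have i2 : Integrable (fun v : Evec N => Real.log β * g v) volume := hg.const_mul _
  simp only [ckD_FD hβ]
  have k1 : Integrable (fun v => entFn (g v) + (1 / 2) * (‖v‖ ^ 2 * g v)) volume := hs.add i1
  have k2 : Integrable (fun v => entFn (g v) + (1 / 2) * (‖v‖ ^ 2 * g v) + Real.log β * g v)
    volume := k1.add i2
  refine ⟨k2.sub (FD_logint hβ), ?_⟩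
  rw [integral_sub k2 (FD_logint hβ), integral_add k1 i2,
    integral_add hs i1, integral_const_mul, integral_const_mul]
  rfl

/-- **Csiszár-Kullback type inequality (Corollary 4.3 of [CRS]).** For measurable
`f : ℝ^N → [0,1]` with mass `M > 0` and finite kinetic energy,
`‖f - F_M‖₁² ≤ 2M (H(f) - H(F_M))`. -/
theorem csiszar_kullback
    (N : ℕ) (hN : 1 ≤ N) (M : ℝ) (hM : 0 < M)
    (f : Evec N → ℝ) (hmeas : Measurable f)
    (hb : ∀ᵐ v : Evec N ∂volume, 0 ≤ f v ∧ f v ≤ 1)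
    (hmass : ∫ v : Evec N, f v = M)
    (hE : Integrable (fun v : Evec N => ‖v‖ ^ 2 * f v) volume) :
    (∫ v : Evec N, |f v - FDM N M v|) ^ 2 ≤ 2 * M * (Hfun N f - Hfun N (FDM N M)) := by
  obtain ⟨hβ, hFmass⟩ := Classical.epsilon_spec (beta_exists N hN M hM)
  change 0 < betaOf N M at hβ
  change ∫ v : Evec N, FD N (betaOf N M) v = M at hFmass
  unfold FDM
  generalize betaOf N M = β at hβ hFmass
  have hf : Integrable f volume := by
    by_contra h
    rw [integral_undef h] at hmass
    exact hM.ne hmass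
  have hF := FD_int (N := N) hβ
  obtain ⟨hDi, hD⟩ := ckD_integral hβ hmeas hb hf hE
  obtain ⟨-, hD'⟩ := ckD_integral hβ (FD_cont (N := N) hβ).measurable
    (ae_of_all _ fun v => ⟨(FD_pos hβ v).le, (FD_lt_one hβ v).le⟩) hF (FD_energy hβ)
  simp only [ckD_self, integral_zero] at hD'
  rw [hFmass] at hD'
  rw [hmass] at hD
  have hK : ∫ v, ckD (f v) (FD N β v) = Hfun N f - Hfun N (FD N β) := by linarith
  rw [← hK]
  set A := ∫ v : Evec N, |f v - FD N β v| with hA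
  set K := ∫ v, ckD (f v) (FD N β v) with hKd
  have hA0 : 0 ≤ A := integral_nonneg fun v => abs_nonneg _
  have hK0 : 0 ≤ K := integral_nonneg_of_ae (by
    filter_upwards [hb] with v hv
    exact ckD_nonneg hv.1 hv.2 (FD_pos hβ v) (FD_lt_one hβ v))
  have key : ∀ t : ℝ, 0 < t → A ≤ t * K + (1 / (6 * t)) * (M + 2 * M) := by
    intro t ht
    have j1 : Integrable (fun v => t * ckD (f v) (FD N β v)) volume := hDi.const_mul _
    have j3 : Integrable (fun v => f v + 2 * FD N β v) volume := hf.add (hF.const_mul 2)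
    have j2 : Integrable (fun v => (1 / (6 * t)) * (f v + 2 * FD N β v)) volume := j3.const_mul _
    calc A ≤ ∫ v, (t * ckD (f v) (FD N β v) + (1 / (6 * t)) * (f v + 2 * FD N β v)) := by
          apply integral_mono_ae (hf.sub hF).abs (j1.add j2)
          filter_upwards [hb] with v hv
          exact ckD_young hv.1 hv.2 (FD_pos hβ v) (FD_lt_one hβ v) ht
      _ = t * K + (1 / (6 * t)) * (M + 2 * M) := by
          rw [integral_add j1 j2, integral_const_mul, integral_const_mul,
            integral_add hf (hF.const_mul 2), integral_const_mul, hmass, hFmass]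
  rcases hA0.eq_or_lt with h | h
  · rw [← h]
    have : 0 ≤ 2 * M * K := by positivity
    simpa using this
  · have hk := key (M / A) (by positivity)
    have e : M / A * K + (1 / (6 * (M / A))) * (M + 2 * M) = M * K / A + A / 2 := by
      field_simp
      ring
    rw [e] at hk
    have h3 : A / 2 ≤ M * K / A := by linarith
    rw [le_div_iff₀ h] at h3
    nlinarith
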